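/- Suppose δ is an infinite cardinal with 2^δ = δ⁺, and λ > δ⁺ is a regular cardinal which is either inaccessible or the successor of a cardinal of cofinality > δ. Then the partial ordering K(δ,λ) satisfies the δ⁺⁺-chain condition: K(δ,λ) has no antichain of cardinality δ⁺⁺. In fact, every family of δ⁺⁺ many conditions of K(δ,λ) contains δ⁺⁺ many pairwise compatible conditions. -/

import Mathlib

open Cardinal

/-- A condition in `K(κ₀,κ₁)`: a triple `⟨w, α, r̄⟩` where `w ⊆ κ₁` has cardinality `κ₀`,
`α < κ₀`, and `r̄ = ⟨r_i : i ∈ w⟩` is a sequence of functions from `α` to `{0,1}`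
(represented as a total function `r`, whose values are only relevant for `i ∈ w` and
arguments `< α`). -/
structure KCond (κ₀ κ₁ : Cardinal.{0}) where
  /-- the support `w` -/
  w : Set Ordinal.{0}
  /-- the common domain `α` of the functions `r_i` -/
  bound : Ordinal.{0}
  /-- `r i ξ` is the value `r_i(ξ)` for `i ∈ w` and `ξ < bound` -/
  r : Ordinal.{0} → Ordinal.{0} → Bool
  w_sub : w ⊆ Set.Iio κ₁.ord
  w_card : #w = Cardinal.lift.{1} κ₀
  bound_lt : bound < κ₀.ord

/-- The ordering on `K(κ₀,κ₁)`. -/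
def KCond.le {κ₀ κ₁ : Cardinal.{0}} (p q : KCond κ₀ κ₁) : Prop :=
  p.w ⊆ q.w ∧ p.bound ≤ q.bound ∧
    (∀ i ∈ p.w, ∀ ξ < p.bound, p.r i ξ = q.r i ξ) ∧
    #{i : Ordinal.{0} | i ∈ p.w ∧ ∃ ξ, p.bound ≤ ξ ∧ ξ < q.bound ∧ q.r i ξ ≠ false} <
      Cardinal.lift.{1} κ₀

/-- Two conditions are compatible if some condition extends both. -/
def KCond.Compatible {κ₀ κ₁ : Cardinal.{0}} (p q : KCond κ₀ κ₁) : Prop :=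
  ∃ s : KCond κ₀ κ₁, p.le s ∧ q.le s

namespace Cardinal

universe u

/-- If `θ ^ d = θ`, a set operation that sends sets of size at most `d` to sets of size at most `θ`
admits a set of size at most `θ` closed under it. -/
theorem exists_mk_le_forall_subset_of_power_eq {U : Type u} {d θ : Cardinal.{u}} (hθ : ℵ₀ ≤ θ)
    (hpow : θ ^ d = θ) (c : Set U → Set U) (hc : ∀ R : Set U, #R ≤ d → #(c R) ≤ θ) :
    ∃ N : Set U, #N ≤ θ ∧ ∀ R ⊆ N, #R ≤ d → c R ⊆ N := by
  classical
  have henum : ∀ R : Set U, ∃ g : θ.out → Option U,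
      #R ≤ d → ∀ x ∈ c R, ∃ t, g t = some x := by
    intro R
    by_cases hR : #R ≤ d
    · have h : #(c R) ≤ #θ.out := by simpa using hc R hR
      obtain ⟨e⟩ := h
      refine ⟨Function.extend e (fun x => some x.1) fun _ => none, fun _ x hx => ⟨e ⟨x, hx⟩, ?_⟩⟩
      rw [e.injective.extend_apply]
    · exact ⟨fun _ => none, fun h => absurd h hR⟩
  choose g hg using henum
  let β : Option θ.out → Type u := fun o => o.elim PEmpty fun _ => d.out
  let leaf : WType β := WType.mk none PEmpty.elim
  let node : θ.out → (d.out → WType β) → WType β := fun t f => WType.mk (some t) f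
  let step : (Σ o : Option θ.out, β o → Option U) → Option U := fun p =>
    match p with
    | ⟨none, _⟩ => none
    | ⟨some t, f⟩ => g {x | ∃ i, f i = some x} t
  let ev : WType β → Option U := WType.elim (Option U) step
  have hleaf : ev leaf = none := rfl
  have hnode : ∀ t f, ev (node t f) = g {x | ∃ i, ev (f i) = some x} t := fun _ _ => rfl
  have hW : #(WType β) ≤ θ := by
    apply WType.cardinalMk_le_of_le
    have hle : ∀ o : Option θ.out, θ ^ #(β o) ≤ θ := by
      rintro (_ | t)
      · change θ ^ #PEmpty ≤ θ
        simpa using one_le_aleph0.trans hθ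
      · change θ ^ #d.out ≤ θ
        simp [hpow]
    refine (sum_le_sum _ _ hle).trans ?_
    rw [sum_const', mk_option, mk_out, add_one_of_aleph0_le hθ, mul_eq_self hθ]
  refine ⟨{x | ∃ w, ev w = some x}, ?_, ?_⟩
  · have h : ∀ x : {x | ∃ w, ev w = some x}, ∃ w, ev w = some x.1 := fun x => x.2
    choose k hk using h
    refine (mk_le_of_injective (f := k) fun x y hxy => ?_).trans hW
    exact Subtype.ext (Option.some_injective _ ((hk x).symm.trans (hxy ▸ hk y)))
  · intro R hRN hR x hx
    have hR' : #R ≤ #d.out := by simpa using hR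
    obtain ⟨e⟩ := hR'
    choose k hk using fun y : R => hRN y.2
    let f : d.out → WType β := Function.extend e k fun _ => leaf
    have hf : {x | ∃ i, ev (f i) = some x} = R := by
      ext y
      constructor
      · rintro ⟨i, hi⟩
        by_cases h : ∃ z, e z = i
        · obtain ⟨z, rfl⟩ := h
          simp only [f, e.injective.extend_apply, hk] at hi
          exact Option.some_injective _ hi ▸ z.2
        · simp [f, Function.extend_apply' _ _ _ h, hleaf] at hi
      · intro hy
        exact ⟨e ⟨y, hy⟩, by simp only [f, e.injective.extend_apply, hk]⟩
    obtain ⟨t, ht⟩ := hg R hR x hx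
    exact ⟨node t f, by rw [hnode, hf, ht]⟩

/-- The Δ-system lemma for families of more than `θ` sets of size at most `d`,
where `θ ^ d = θ`. -/
theorem exists_deltaSystem {I U : Type u} {d θ : Cardinal.{u}} (hθ : ℵ₀ ≤ θ) (hdθ : d ≤ θ)
    (hpow : θ ^ d = θ) (w : I → Set U) (hw : ∀ a, #(w a) ≤ d) (hI : θ < #I) :
    ∃ (R : Set U) (G : Set I), θ < #G ∧ (∀ a ∈ G, R ⊆ w a) ∧
      G.Pairwise fun a b => w a ∩ w b ⊆ R := by
  have hmax : ∀ R : Set U, ∃ G : Set I,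
      Maximal (· ∈ {G : Set I | (∀ a ∈ G, R ⊆ w a) ∧ G.Pairwise fun a b => w a ∩ w b ⊆ R}) G := by
    intro R
    refine zorn_subset _ fun C hC hchain => ⟨⋃₀ C, ⟨?_, ?_⟩, fun s hs => Set.subset_sUnion_of_mem hs⟩
    · rintro a ⟨s, hs, ha⟩
      exact (hC hs).1 a ha
    · exact (Set.pairwise_sUnion hchain.directedOn).2 fun s hs => (hC hs).2
  choose G hG using hmax
  by_contra! hcon
  have hsmall : ∀ R, #(G R) ≤ θ := fun R =>
    not_lt.1 fun h => hcon R (G R) h (hG R).prop.1 (hG R).prop.2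
  obtain ⟨N, hN, hclosed⟩ := exists_mk_le_forall_subset_of_power_eq hθ hpow
    (fun R => ⋃ a ∈ G R, w a) fun R _ => by
      calc #(⋃ a ∈ G R, w a) ≤ #(G R) * ⨆ a : G R, #(w a.1) := mk_biUnion_le _ _
        _ ≤ θ * θ := mul_le_mul' (hsmall R) (ciSup_le' fun a => (hw a.1).trans hdθ)
        _ = θ := mul_eq_self hθ
  have hcover : ∀ a, a ∈ G (w a ∩ N) := by
    intro a
    set R := w a ∩ N
    have hRd : #R ≤ d := (mk_le_mk_of_subset Set.inter_subset_left).trans (hw a)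
    have hsub := hclosed R Set.inter_subset_right hRd
    refine (hG R).le_of_ge (y := insert a (G R)) ⟨?_, ?_⟩ (Set.subset_insert _ _)
      (Set.mem_insert _ _)
    · rintro b (rfl | hb)
      · exact Set.inter_subset_left
      · exact (hG R).prop.1 b hb
    · refine (hG R).prop.2.insert fun b hb _ => ?_
      have hbN : w b ⊆ N := (Set.subset_biUnion_of_mem (u := w) hb).trans hsub
      exact ⟨Set.inter_subset_inter_right _ hbN,
        (Set.inter_comm _ _).trans_subset (Set.inter_subset_inter_right _ hbN)⟩
  have huniv : (Set.univ : Set I) ⊆ ⋃ R : {R : Set U // R ⊆ N ∧ #R ≤ d}, G R.1 := fun a _ =>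
    Set.mem_iUnion.2 ⟨⟨w a ∩ N, Set.inter_subset_right,
      (mk_le_mk_of_subset Set.inter_subset_left).trans (hw a)⟩, hcover a⟩
  refine hI.not_ge ?_
  have hroots : #{R : Set U // R ⊆ N ∧ #R ≤ d} ≤ θ :=
    (mk_bounded_subset_le N d).trans ((power_le_power_right (max_le hN hθ)).trans hpow.le)
  calc #I = #(Set.univ : Set I) := mk_univ.symm
    _ ≤ #(⋃ R : {R : Set U // R ⊆ N ∧ #R ≤ d}, G R.1) := mk_le_mk_of_subset huniv
    _ ≤ _ * _ := mk_iUnion_le_sum_mk.trans (sum_le_mk_mul_iSup _)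
    _ ≤ θ * θ := mul_le_mul' hroots (ciSup_le' fun R => hsmall R.1)
    _ = θ := mul_eq_self hθ

end Cardinal

namespace KCond

variable {κ₀ κ₁ : Cardinal.{0}}

theorem le_of_bound_eq {p s : KCond κ₀ κ₁} (hκ : 0 < κ₀) (hw : p.w ⊆ s.w)
    (hb : p.bound = s.bound) (hr : ∀ i ∈ p.w, ∀ ξ < p.bound, p.r i ξ = s.r i ξ) : p.le s := by
  refine ⟨hw, hb.le, hr, ?_⟩
  have : {i : Ordinal.{0} | i ∈ p.w ∧ ∃ ξ, p.bound ≤ ξ ∧ ξ < s.bound ∧ s.r i ξ ≠ false} = ∅ := by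
    ext i
    simp only [Set.mem_ofPred_eq, Set.mem_empty_iff_false, iff_false]
    rintro ⟨-, ξ, h₁, h₂, -⟩
    exact h₂.not_ge (hb ▸ h₁)
  rw [this]
  simpa using hκ

theorem compatible_self (hκ : 0 < κ₀) (p : KCond κ₀ κ₁) : p.Compatible p :=
  ⟨p, le_of_bound_eq hκ subset_rfl rfl fun _ _ _ _ => rfl,
    le_of_bound_eq hκ subset_rfl rfl fun _ _ _ _ => rfl⟩

/-- Two conditions with the same bound which agree on their common support are compatible. -/
theorem compatible_of_eqOn_inter (hκ : ℵ₀ ≤ κ₀) {p q : KCond κ₀ κ₁} (hb : p.bound = q.bound)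
    (hr : ∀ i ∈ p.w ∩ q.w, ∀ ξ < p.bound, p.r i ξ = q.r i ξ) : p.Compatible q := by
  classical
  have hpos : 0 < κ₀ := aleph0_pos.trans_le hκ
  let s : KCond κ₀ κ₁ :=
    { w := p.w ∪ q.w
      bound := p.bound
      r := fun i ξ => if i ∈ p.w then p.r i ξ else q.r i ξ
      w_sub := Set.union_subset p.w_sub q.w_sub
      w_card := by
        apply le_antisymm
        · refine (mk_union_le _ _).trans ?_
          rw [p.w_card, q.w_card, add_eq_self (aleph0_le_lift.2 hκ)]
        · rw [← p.w_card]
          exact mk_le_mk_of_subset Set.subset_union_left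
      bound_lt := p.bound_lt }
  refine ⟨s, le_of_bound_eq hpos Set.subset_union_left rfl fun i hi ξ _ => ?_,
    le_of_bound_eq hpos Set.subset_union_right hb.symm fun i hi ξ hξ => ?_⟩
  · simp [s, hi]
  · by_cases h : i ∈ p.w
    · simp [s, h, hr i ⟨h, hi⟩ ξ (hb ▸ hξ)]
    · simp [s, h]

/-- If `2 ^ κ₀ = κ₀⁺`, then among any `κ₀⁺⁺` conditions there are `κ₀⁺⁺` pairwise compatible
ones. -/
theorem exists_pairwise_compatible (hκ : ℵ₀ ≤ κ₀) (hgch : 2 ^ κ₀ = Order.succ κ₀)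
    (A : Set (KCond κ₀ κ₁)) (hA : #A = Cardinal.lift.{1} (Order.succ (Order.succ κ₀))) :
    ∃ B ⊆ A, #B = Cardinal.lift.{1} (Order.succ (Order.succ κ₀)) ∧
      ∀ p ∈ B, ∀ q ∈ B, Compatible p q := by
  set d : Cardinal.{1} := Cardinal.lift.{1} κ₀ with hd
  set θ : Cardinal.{1} := Order.succ d with hθdef
  have hlift : Cardinal.lift.{1} (Order.succ (Order.succ κ₀)) = Order.succ θ := by
    rw [lift_succ, lift_succ]
  have hdinf : ℵ₀ ≤ d := aleph0_le_lift.2 hκ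
  have htwo : (2 : Cardinal.{1}) ^ d = θ := by
    rw [hθdef, hd, ← lift_succ, ← hgch, lift_power, lift_two]
  have hdθ : d ≤ θ := Order.le_succ d
  have hθ : ℵ₀ ≤ θ := hdinf.trans hdθ
  have hpow : θ ^ d = θ := by rw [← htwo, ← power_mul, mul_eq_self hdinf]
  rw [hlift] at hA ⊢
  obtain ⟨R, G, hG, hRG, hGR⟩ := exists_deltaSystem hθ hdθ hpow (fun p : A => p.1.w)
    (fun p => p.1.w_card.le) (hA ▸ Order.lt_succ θ)
  have hRd : #R ≤ d := by
    have : Nonempty G := mk_ne_zero_iff.1 (pos_of_gt hG).ne'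
    obtain ⟨a⟩ := this
    exact (mk_le_mk_of_subset (hRG a.1 a.2)).trans a.1.1.w_card.le
  have hIio : #(Set.Iio κ₀.ord) = d := by rw [Cardinal.mk_Iio_ordinal, card_ord]
  let colour : G → Set.Iio κ₀.ord × (R × Set.Iio κ₀.ord → Bool) := fun p =>
    (⟨p.1.1.bound, p.1.1.bound_lt⟩, fun x => p.1.1.r x.1 x.2)
  have hcolour : #(Set.Iio κ₀.ord × (R × Set.Iio κ₀.ord → Bool)) ≤ θ := by
    have h : #(R × Set.Iio κ₀.ord → Bool) ≤ θ := by
      have : #(R × Set.Iio κ₀.ord) ≤ d := by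
        rw [mk_prod, lift_id, lift_id, hIio]
        exact (mul_le_mul' hRd le_rfl).trans (mul_eq_self hdinf).le
      calc #(R × Set.Iio κ₀.ord → Bool) = 2 ^ #(R × Set.Iio κ₀.ord) := by simp
        _ ≤ 2 ^ d := power_le_power_left two_ne_zero this
        _ = θ := htwo
    rw [mk_prod, lift_id, lift_id, hIio]
    exact (mul_le_mul' hdθ h).trans (mul_eq_self hθ).le
  obtain ⟨x, hx⟩ := infinite_pigeonhole_card colour (Order.succ θ) (Order.succ_le_of_lt hG)
    (hθ.trans (Order.le_succ θ))
    ((Order.lt_succ_of_le hcolour).trans_le (isRegular_succ hθ).2)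
  let B : Set (KCond κ₀ κ₁) := (fun p : G => p.1.1) '' (colour ⁻¹' {x})
  have hBA : B ⊆ A := by
    rintro _ ⟨p, -, rfl⟩
    exact p.1.2
  refine ⟨B, hBA, le_antisymm ((mk_le_mk_of_subset hBA).trans hA.le) ?_, ?_⟩
  · exact hx.trans_eq (mk_image_eq (Subtype.val_injective.comp Subtype.val_injective)).symm
  · rintro _ ⟨p, hp, rfl⟩ _ ⟨q, hq, rfl⟩
    rcases eq_or_ne p q with rfl | hpq
    · exact compatible_self (aleph0_pos.trans_le hκ) _
    · have hc : colour p = colour q := hp.trans hq.symm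
      refine compatible_of_eqOn_inter hκ (congrArg (fun c => c.1.1) hc) fun i hi ξ hξ => ?_
      have hiR : i ∈ R := hGR p.2 q.2 (fun h => hpq (Subtype.ext h)) hi
      exact congrFun (congrArg Prod.snd hc) (⟨i, hiR⟩, ⟨ξ, hξ.trans p.1.1.bound_lt⟩)

end KCond

/-- If `2^δ = δ⁺` and `λ > δ⁺` is regular and either inaccessible or the
successor of a cardinal of cofinality `> δ`, then `K(δ,λ)` satisfies the `δ⁺⁺`-chain
condition; in fact any family of `δ⁺⁺` many conditions contains `δ⁺⁺` many pairwise
compatible ones. -/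
theorem K_delta_plus_plus_cc (δ lam : Cardinal.{0})
    (hδ : ℵ₀ ≤ δ) (hgch : 2 ^ δ = Order.succ δ)
    (hlam_gt : Order.succ δ < lam) (hlam_reg : lam.IsRegular)
    (hlam : lam.IsInaccessible ∨
      ∃ μ : Cardinal.{0}, lam = Order.succ μ ∧ δ < Ordinal.cof μ.ord) :
    (∀ A : Set (KCond δ lam),
        (∀ p ∈ A, ∀ q ∈ A, p ≠ q → ¬ KCond.Compatible p q) →
        #A ≠ Cardinal.lift.{1} (Order.succ (Order.succ δ))) ∧
      ∀ A : Set (KCond δ lam), #A = Cardinal.lift.{1} (Order.succ (Order.succ δ)) →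
        ∃ B ⊆ A, #B = Cardinal.lift.{1} (Order.succ (Order.succ δ)) ∧
          ∀ p ∈ B, ∀ q ∈ B, KCond.Compatible p q := by
  have hmain := KCond.exists_pairwise_compatible (κ₁ := lam) hδ hgch
  refine ⟨fun A hA hcard => ?_, hmain⟩
  obtain ⟨B, hBA, hB, hcomp⟩ := hmain A hcard
  have hone : 1 < #B := by
    rw [hB]
    exact one_lt_aleph0.trans_le
      (aleph0_le_lift.2 (hδ.trans ((Order.le_succ δ).trans (Order.le_succ _))))
  obtain ⟨p, q, hpq⟩ := one_lt_iff_nontrivial.1 hone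
  exact hA p (hBA p.2) q (hBA q.2) (fun h => hpq (Subtype.ext h)) (hcomp p p.2 q q.2)
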